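/- arXiv:1704.01197 — 12 statements merged into one kernel-verified Lean document; each statement's English description precedes it below -/
import Mathlib

section
/- Let (g, Ω, ϑ) be an exact lcs Lie algebra with primitive η, let U be the unique vector with Ω(U, Y) = -η(Y) for all Y, and let V be the characteristic vector. Then: (i) Ω(U, V) = -ϑ(U), and the restriction of Ω to the linear span of {U, V} is nondegenerate if and only if ϑ(U) ≠ 0; (ii) L_U Ω = (ϑ(U) - 1)·Ω, explicitly Ω([U,X], Y) + Ω(X, [U,Y]) = (1 - ϑ(U))·Ω(X, Y) for all X, Y. In particular U is an infinitesimal automorphism (so the lcs structure is of the first kind via U) if and only if ϑ(U) = 1. -/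
/-- For an exact lcs Lie algebra `(g, Ω, ϑ)` with primitive `η`,
`U` the vector with `Ω(U,·) = -η` and `V` the characteristic vector:
(i) `Ω(U,V) = -ϑ(U)` and `Ω` is nondegenerate on `span{U,V}` iff `ϑ(U) ≠ 0`;
(ii) `L_U Ω = (ϑ(U)-1)·Ω`, and `U` is an infinitesimal automorphism iff `ϑ(U) = 1`. -/
theorem stmt_0
    {g : Type*} [LieRing g] [LieAlgebra ℝ g] [Module.Finite ℝ g]
    (n : ℕ) (hn : 2 ≤ n) (hdim : Module.finrank ℝ g = 2 * n)
    (Ω : g →ₗ[ℝ] g →ₗ[ℝ] ℝ) (ϑ η : g →ₗ[ℝ] ℝ)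
    (hΩalt : ∀ X Y : g, Ω X Y = - Ω Y X)
    (hΩnd : ∀ X : g, (∀ Y : g, Ω X Y = 0) → X = 0)
    (hϑ : ϑ ≠ 0)
    (hϑclosed : ∀ X Y : g, ϑ ⁅X, Y⁆ = 0)
    (hlcs : ∀ X Y Z : g,
      -Ω ⁅X, Y⁆ Z + Ω ⁅X, Z⁆ Y - Ω ⁅Y, Z⁆ X
        = ϑ X * Ω Y Z - ϑ Y * Ω X Z + ϑ Z * Ω X Y)
    (hexact : ∀ X Y : g, Ω X Y = -η ⁅X, Y⁆ - ϑ X * η Y + ϑ Y * η X)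
    (U V : g)
    (hU : ∀ Y : g, Ω U Y = -η Y)
    (hV : ∀ Y : g, Ω V Y = ϑ Y) :
    (Ω U V = -ϑ U) ∧
    ((∀ X ∈ Submodule.span ℝ ({U, V} : Set g),
        (∀ Y ∈ Submodule.span ℝ ({U, V} : Set g), Ω X Y = 0) → X = 0) ↔ ϑ U ≠ 0) ∧
    (∀ X Y : g, Ω ⁅U, X⁆ Y + Ω X ⁅U, Y⁆ = (1 - ϑ U) * Ω X Y) ∧
    ((∀ Y Z : g, Ω ⁅U, Y⁆ Z + Ω Y ⁅U, Z⁆ = 0) ↔ ϑ U = 1) := by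
  have hself : ∀ X : g, Ω X X = 0 := fun X => by linarith [hΩalt X X]
  have h1 : Ω U V = -ϑ U := by rw [hΩalt, hV]
  have hV0 : V ≠ 0 := by
    rintro rfl
    apply hϑ
    ext Y
    rw [← hV Y]
    simp
  have h3 : ∀ X Y : g, Ω ⁅U, X⁆ Y + Ω X ⁅U, Y⁆ = (1 - ϑ U) * Ω X Y := by
    intro X Y
    have e := hlcs U X Y
    rw [hΩalt ⁅U, Y⁆ X, hΩalt ⁅X, Y⁆ U, hU, hU, hU] at e
    linarith [hexact X Y]
  refine ⟨h1, ⟨?_, ?_⟩, h3, ⟨?_, ?_⟩⟩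
  · intro h h0
    apply hV0
    refine h V (Submodule.subset_span (by simp)) ?_
    intro Y hY
    obtain ⟨a, b, rfl⟩ := Submodule.mem_span_pair.1 hY
    rw [map_add, map_smul, map_smul, hself, hV, h0]
    simp
  · intro h0 X hX h
    obtain ⟨a, b, rfl⟩ := Submodule.mem_span_pair.1 hX
    have hu := h U (Submodule.subset_span (by simp))
    have hv := h V (Submodule.subset_span (by simp))
    simp only [map_add, map_smul, LinearMap.add_apply, LinearMap.smul_apply, hself, h1, hV U,
      smul_eq_mul, mul_zero, zero_add, add_zero] at hu hv
    have ha : a = 0 := by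
      rcases mul_eq_zero.1 hv with h' | h'
      · exact h'
      · exact absurd (neg_eq_zero.1 h') h0
    have hb : b = 0 := (mul_eq_zero.1 hu).resolve_right h0
    simp [ha, hb]
  · intro h
    by_contra hne
    apply hϑ
    ext Y
    have e := h3 V Y
    rw [h, hV] at e
    rcases mul_eq_zero.1 e.symm with h' | h'
    · exact absurd (by linarith) hne
    · simpa using h'
  · intro h Y Z
    rw [h3, h]
    simp
end

section
/- Let (g, Ω, ϑ) be an lcs Lie algebra and suppose U ∈ g is an infinitesimal automorphism with ϑ(U) = 1 (so the structure is of the first kind). Define η : g → ℝ by η(Y) := -Ω(U, Y). Then Ω = dη - ϑ∧η, i.e. Ω(X, Y) = -η([X,Y]) - ϑ(X)η(Y) + ϑ(Y)η(X) for all X, Y. In particular every lcs structure of the first kind is exact. -/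
/-- If `(g, Ω, ϑ)` is an lcs Lie algebra and `U` is an infinitesimal
automorphism with `ϑ(U) = 1`, then setting `η(Y) = -Ω(U,Y)` one has
`Ω = dη - ϑ∧η`; in particular every lcs structure of the first kind is exact. -/
theorem stmt_1
    {g : Type*} [LieRing g] [LieAlgebra ℝ g] [Module.Finite ℝ g]
    (n : ℕ) (hn : 2 ≤ n) (hdim : Module.finrank ℝ g = 2 * n)
    (Ω : g →ₗ[ℝ] g →ₗ[ℝ] ℝ) (ϑ : g →ₗ[ℝ] ℝ)
    (hΩalt : ∀ X Y : g, Ω X Y = - Ω Y X)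
    (hΩnd : ∀ X : g, (∀ Y : g, Ω X Y = 0) → X = 0)
    (hϑ : ϑ ≠ 0)
    (hϑclosed : ∀ X Y : g, ϑ ⁅X, Y⁆ = 0)
    (hlcs : ∀ X Y Z : g,
      -Ω ⁅X, Y⁆ Z + Ω ⁅X, Z⁆ Y - Ω ⁅Y, Z⁆ X
        = ϑ X * Ω Y Z - ϑ Y * Ω X Z + ϑ Z * Ω X Y)
    (U : g)
    (hUaut : ∀ Y Z : g, Ω ⁅U, Y⁆ Z + Ω Y ⁅U, Z⁆ = 0)
    (hUϑ : ϑ U = 1) :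
    ∀ X Y : g,
      Ω X Y = -(-Ω U ⁅X, Y⁆) - ϑ X * (-Ω U Y) + ϑ Y * (-Ω U X) := by
  intro X Y
  have h1 := hlcs U X Y
  have h2 := hUaut X Y
  have h3 := hΩalt ⁅U, Y⁆ X
  have h4 := hΩalt ⁅X, Y⁆ U
  rw [hUϑ] at h1
  linarith
end

section
/- Let (g, Ω, ϑ) be an exact lcs Lie algebra with primitive η, let U be the unique vector with Ω(U, Y) = -η(Y) for all Y, and assume ϑ(U) ≠ 0. Set h := ker ϑ. Then: (a) for every X ∈ h one has η([U, X]) = (1 - ϑ(U))·η(X) (the derivation D = ad U of the ideal h satisfies D*η = (1 - ϑ(U))·η); (b) η restricts to a contact form on h, in the sense that the skew form (X, Y) ↦ -η([X, Y]) is nondegenerate on h ∩ ker η: for every nonzero X ∈ h with η(X) = 0 there exists Y ∈ h with η(Y) = 0 and η([X, Y]) ≠ 0; (c) g = h ⊕ ℝ·U as a direct sum of vector spaces. -/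
/-- For an exact lcs Lie algebra `(g, Ω, ϑ)` with primitive `η`,
`U` the vector with `Ω(U,·) = -η`, assuming `ϑ(U) ≠ 0` and setting `h = ker ϑ`:
(a) `η([U,X]) = (1-ϑ(U))·η(X)` for `X ∈ h`; (b) `η` restricts to a contact form
on `h`; (c) `g = h ⊕ ℝ·U` as vector spaces. -/
theorem stmt_2
    {g : Type*} [LieRing g] [LieAlgebra ℝ g] [Module.Finite ℝ g]
    (n : ℕ) (hn : 2 ≤ n) (hdim : Module.finrank ℝ g = 2 * n)
    (Ω : g →ₗ[ℝ] g →ₗ[ℝ] ℝ) (ϑ η : g →ₗ[ℝ] ℝ)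
    (hΩalt : ∀ X Y : g, Ω X Y = - Ω Y X)
    (hΩnd : ∀ X : g, (∀ Y : g, Ω X Y = 0) → X = 0)
    (hϑ : ϑ ≠ 0)
    (hϑclosed : ∀ X Y : g, ϑ ⁅X, Y⁆ = 0)
    (hlcs : ∀ X Y Z : g,
      -Ω ⁅X, Y⁆ Z + Ω ⁅X, Z⁆ Y - Ω ⁅Y, Z⁆ X
        = ϑ X * Ω Y Z - ϑ Y * Ω X Z + ϑ Z * Ω X Y)
    (hexact : ∀ X Y : g, Ω X Y = -η ⁅X, Y⁆ - ϑ X * η Y + ϑ Y * η X)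
    (U : g)
    (hU : ∀ Y : g, Ω U Y = -η Y)
    (hϑU : ϑ U ≠ 0) :
    (∀ X : g, ϑ X = 0 → η ⁅U, X⁆ = (1 - ϑ U) * η X) ∧
    (∀ X : g, ϑ X = 0 → η X = 0 → X ≠ 0 →
      ∃ Y : g, ϑ Y = 0 ∧ η Y = 0 ∧ η ⁅X, Y⁆ ≠ 0) ∧
    IsCompl (LinearMap.ker ϑ) (Submodule.span ℝ ({U} : Set g)) := by
  have hUU : η U = 0 := by
    have h1 := hU U
    have h2 := hΩalt U U
    linarith
  have hinj : Function.Injective Ω := by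
    rw [injective_iff_map_eq_zero]
    intro X hX
    exact hΩnd X (fun Y => by rw [hX]; rfl)
  have hsurj : Function.Surjective Ω :=
    (LinearMap.injective_iff_surjective_of_finrank_eq_finrank
      (Subspace.dual_finrank_eq (K := ℝ) (V := g)).symm).1 hinj
  obtain ⟨V, hV⟩ := hsurj ϑ
  have hV' : ∀ Y, Ω V Y = ϑ Y := fun Y => by rw [hV]
  have hϑV : ϑ V = 0 := by
    have h1 := hV' V
    have h2 := hΩalt V V
    linarith
  have hηV : η V = ϑ U := by
    have h1 := hU V
    have h2 := hΩalt U V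
    have h3 := hV' U
    linarith
  refine ⟨?_, ?_, ?_⟩
  · intro X hX
    have h1 := hexact U X
    rw [hU, hX] at h1
    linarith
  · intro X hX hηX hX0
    obtain ⟨Y, hY⟩ : ∃ Y, Ω X Y ≠ 0 := by
      by_contra! h
      exact hX0 (hΩnd X h)
    have hXU : Ω X U = 0 := by rw [hΩalt, hU, hηX]; simp
    have hXV : Ω X V = 0 := by rw [hΩalt, hV', hX]; simp
    have hϑY : ϑ (Y - (ϑ Y / ϑ U) • U - (η Y / ϑ U) • V) = 0 := by
      simp [hϑV, hϑU]
    refine ⟨Y - (ϑ Y / ϑ U) • U - (η Y / ϑ U) • V, hϑY, ?_, ?_⟩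
    · simp [hUU, hηV, hϑU]
    · intro h0
      have h1 := hexact X (Y - (ϑ Y / ϑ U) • U - (η Y / ϑ U) • V)
      rw [h0, hX, hηX] at h1
      simp only [map_sub, map_smul, hXU, hXV] at h1
      apply hY
      simpa using h1
  · refine IsCompl.of_le ?_ ?_
    · rintro x ⟨hx1, hx2⟩
      obtain ⟨c, rfl⟩ := Submodule.mem_span_singleton.1 hx2
      have h1 : ϑ (c • U) = 0 := hx1
      have hc : c = 0 := by simpa [hϑU] using h1
      simp [hc]
    · intro x _
      refine Submodule.mem_sup.2 ⟨x - (ϑ x / ϑ U) • U, ?_, (ϑ x / ϑ U) • U,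
        Submodule.smul_mem _ _ (Submodule.mem_span_singleton_self U), by simp⟩
      simp [hϑU]
end

section
/- Let g be a finite-dimensional real Lie algebra, ϑ : g → ℝ a nonzero closed linear functional (ϑ([X,Y]) = 0 for all X, Y), and set h := ker ϑ. Let η : g → ℝ be linear and suppose: (i) there is ξ ∈ h with η(ξ) = 1 and η([ξ, Y]) = 0 for all Y ∈ h (Reeb vector of the contact form η on h); (ii) for every nonzero X ∈ h with η(X) = 0 there exists Y ∈ h with η(Y) = 0 and η([X, Y]) ≠ 0 (the form -η∘[·,·] is nondegenerate on h ∩ ker η); (iii) there are W ∈ g with ϑ(W) = -1 and η(W) = 0, and a real number α ≠ 1, such that η([W, X]) = α·η(X) for all X ∈ h (the derivation D = ad W of h satisfies D*η = α·η). Then the alternating bilinear form Ω(X, Y) := -η([X, Y]) - ϑ(X)η(Y) + ϑ(Y)η(X) (that is, Ω = dη - ϑ∧η) is nondegenerate and (Ω, ϑ) is an exact lcs structure on g. -/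
/-- Given a Lie algebra `g`, a nonzero closed functional `ϑ` with
`h = ker ϑ`, a contact form `η` on `h` with Reeb vector `ξ`, and `W` with
`ϑ(W) = -1`, `η(W) = 0`, inducing a derivation of `h` with `D*η = α·η`, `α ≠ 1`,
the form `Ω = dη - ϑ∧η` is nondegenerate and `(Ω, ϑ)` is an (exact) lcs structure. -/
theorem stmt_3
    {g : Type*} [LieRing g] [LieAlgebra ℝ g] [Module.Finite ℝ g]
    (ϑ η : g →ₗ[ℝ] ℝ)
    (hϑ : ϑ ≠ 0)
    (hϑclosed : ∀ X Y : g, ϑ ⁅X, Y⁆ = 0)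
    (ξ : g) (hξh : ϑ ξ = 0) (hξη : η ξ = 1)
    (hξReeb : ∀ Y : g, ϑ Y = 0 → η ⁅ξ, Y⁆ = 0)
    (hcontact : ∀ X : g, ϑ X = 0 → η X = 0 → X ≠ 0 →
      ∃ Y : g, ϑ Y = 0 ∧ η Y = 0 ∧ η ⁅X, Y⁆ ≠ 0)
    (W : g) (hWϑ : ϑ W = -1) (hWη : η W = 0)
    (α : ℝ) (hα : α ≠ 1)
    (hD : ∀ X : g, ϑ X = 0 → η ⁅W, X⁆ = α * η X)
    (Ω : g →ₗ[ℝ] g →ₗ[ℝ] ℝ)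
    (hΩ : ∀ X Y : g, Ω X Y = -η ⁅X, Y⁆ - ϑ X * η Y + ϑ Y * η X) :
    (∀ X : g, (∀ Y : g, Ω X Y = 0) → X = 0) ∧
    (∀ X Y Z : g,
      -Ω ⁅X, Y⁆ Z + Ω ⁅X, Z⁆ Y - Ω ⁅Y, Z⁆ X
        = ϑ X * Ω Y Z - ϑ Y * Ω X Z + ϑ Z * Ω X Y) := by
  have skew : ∀ A B : g, η ⁅A, B⁆ = -η ⁅B, A⁆ := by
    intro A B
    rw [← lie_skew, map_neg]
  refine ⟨?_, ?_⟩
  · intro X hX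
    have h1 := hX ξ
    rw [hΩ, hξh, hξη] at h1
    have hX' : ϑ (X + ϑ X • W) = 0 := by
      rw [map_add, map_smul, hWϑ, smul_eq_mul]
      ring
    have h2 := hξReeb _ hX'
    rw [lie_add, lie_smul, map_add, map_smul, smul_eq_mul, skew ξ X, skew ξ W,
      hD ξ hξh, hξη] at h2
    have h3 : ϑ X = 0 := by
      have h4 : ϑ X * (α - 1) = 0 := by linarith
      exact (mul_eq_zero.mp h4).resolve_right (sub_ne_zero.mpr hα)
    have h5 := hX W
    rw [hΩ, skew X W, hD X h3, h3, hWϑ, hWη] at h5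
    have h6 : η X = 0 := by
      have h4 : η X * (α - 1) = 0 := by linarith
      exact (mul_eq_zero.mp h4).resolve_right (sub_ne_zero.mpr hα)
    by_contra hne
    obtain ⟨Y, hY1, hY2, hY3⟩ := hcontact X h3 h6 hne
    have h7 := hX Y
    rw [hΩ, h3, h6] at h7
    apply hY3
    linarith
  · intro X Y Z
    have hJ := congrArg η (lie_jacobi X Y Z)
    rw [map_add, map_add, map_zero, skew X, skew Y, skew Z, ← lie_skew Z X, neg_lie,
      map_neg] at hJ
    simp only [hΩ, hϑclosed]
    linarith
end

section
/- Let (g, Ω, ϑ) be an lcs Lie algebra and let j ⊆ g be an ideal contained in ker ϑ on which Ω vanishes identically (Ω(X, Y) = 0 for all X, Y ∈ j). Then j is abelian: [X, Y] = 0 for all X, Y ∈ j. In particular, every Lagrangian ideal contained in ker ϑ is abelian. -/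
/-- In an lcs Lie algebra `(g, Ω, ϑ)`, any ideal `j ⊆ ker ϑ` on which
`Ω` vanishes identically is abelian. -/
theorem stmt_4
    {g : Type*} [LieRing g] [LieAlgebra ℝ g] [Module.Finite ℝ g]
    (n : ℕ) (hn : 2 ≤ n) (hdim : Module.finrank ℝ g = 2 * n)
    (Ω : g →ₗ[ℝ] g →ₗ[ℝ] ℝ) (ϑ : g →ₗ[ℝ] ℝ)
    (hΩalt : ∀ X Y : g, Ω X Y = - Ω Y X)
    (hΩnd : ∀ X : g, (∀ Y : g, Ω X Y = 0) → X = 0)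
    (hϑ : ϑ ≠ 0)
    (hϑclosed : ∀ X Y : g, ϑ ⁅X, Y⁆ = 0)
    (hlcs : ∀ X Y Z : g,
      -Ω ⁅X, Y⁆ Z + Ω ⁅X, Z⁆ Y - Ω ⁅Y, Z⁆ X
        = ϑ X * Ω Y Z - ϑ Y * Ω X Z + ϑ Z * Ω X Y)
    (j : LieIdeal ℝ g)
    (hjϑ : ∀ X ∈ j, ϑ X = 0)
    (hjiso : ∀ X ∈ j, ∀ Y ∈ j, Ω X Y = 0) :
    ∀ X ∈ j, ∀ Y ∈ j, ⁅X, Y⁆ = (0 : g) := by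
  intro X hX Y hY
  apply hΩnd
  intro Z
  have h1 : ⁅X, Z⁆ ∈ j := lie_mem_left ℝ g j X Z hX
  have h2 : ⁅Y, Z⁆ ∈ j := lie_mem_left ℝ g j Y Z hY
  have h := hlcs X Y Z
  rw [hjiso _ h1 _ hY, hjiso _ h2 _ hX, hjϑ X hX, hjϑ Y hY, hjiso X hX Y hY] at h
  linarith
end

section
/- Let h be a finite-dimensional real Lie algebra and ϑ̂ : h → ℝ a closed linear functional (ϑ̂([X,Y]) = 0 for all X, Y). Let ρ : h → End(h*) be linear and α : h × h → h* alternating bilinear, and suppose the vector space g := h* × h carries a Lie algebra bracket satisfying [(φ,0),(ψ,0)] = 0, [(φ,0),(0,X)] = (-ρ(X)(φ), 0), and [(0,X),(0,Y)] = (α(X,Y), [X,Y]_h). Define Ω₀((φ,X),(ψ,Y)) := φ(Y) - ψ(X) and ϑ(φ,X) := ϑ̂(X). Then ϑ is closed on g, and Ω₀ satisfies the equation dΩ₀ = ϑ ∧ Ω₀ (explicitly: -Ω₀([a,b],c) + Ω₀([a,c],b) - Ω₀([b,c],a) = ϑ(a)Ω₀(b,c) - ϑ(b)Ω₀(a,c)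 + ϑ(c)Ω₀(a,b) for all a, b, c ∈ g) if and only if both of the following hold: (3) α(X,Y)(Z) + α(Y,Z)(X) + α(Z,X)(Y) = 0 for all X, Y, Z ∈ h; and (4) ρ(X)(φ)(Y) - ρ(Y)(φ)(X) = -φ([X,Y]) - ϑ̂(X)φ(Y) + ϑ̂(Y)φ(X) for all X, Y ∈ h and all φ ∈ h* (i.e. the left-hand side equals (d_ϑ̂ φ)(X,Y)). -/
/-- cotangent extension problem in the lcs context. Given a Lie
bracket `B` on `h* × h` determined by a representation `ρ` and a cochain `α`,
the 1-form `ϑ(φ,X) = ϑ̂(X)` is closed, and the canonical 2-form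
`Ω₀((φ,X),(ψ,Y)) = φ(Y) - ψ(X)` satisfies `dΩ₀ = ϑ ∧ Ω₀` iff the cocycle
condition (3) for `α` and the twisted condition (4) for `ρ` hold. -/
theorem stmt_6
    {h : Type*} [LieRing h] [LieAlgebra ℝ h] [Module.Finite ℝ h]
    (ϑ : h →ₗ[ℝ] ℝ)
    (hϑclosed : ∀ X Y : h, ϑ ⁅X, Y⁆ = 0)
    (ρ : h →ₗ[ℝ] Module.End ℝ (Module.Dual ℝ h))
    (α : h →ₗ[ℝ] h →ₗ[ℝ] Module.Dual ℝ h)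
    (hαalt : ∀ X Y : h, α X Y = - α Y X)
    (B : (Module.Dual ℝ h × h) →ₗ[ℝ] (Module.Dual ℝ h × h) →ₗ[ℝ] (Module.Dual ℝ h × h))
    (hBskew : ∀ a b : Module.Dual ℝ h × h, B a b = - B b a)
    (hBjacobi : ∀ a b c : Module.Dual ℝ h × h, B (B a b) c + B (B b c) a + B (B c a) b = 0)
    (hB1 : ∀ φ ψ : Module.Dual ℝ h, B (φ, 0) (ψ, 0) = 0)
    (hB2 : ∀ (φ : Module.Dual ℝ h) (X : h), B (φ, 0) (0, X) = (-(ρ X φ), 0))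
    (hB3 : ∀ X Y : h, B (0, X) (0, Y) = (α X Y, ⁅X, Y⁆)) :
    (∀ a b : Module.Dual ℝ h × h, ϑ (B a b).2 = 0) ∧
    ((∀ a b c : Module.Dual ℝ h × h,
        -((B a b).1 c.2 - c.1 (B a b).2) + ((B a c).1 b.2 - b.1 (B a c).2)
            - ((B b c).1 a.2 - a.1 (B b c).2)
          = ϑ a.2 * (b.1 c.2 - c.1 b.2) - ϑ b.2 * (a.1 c.2 - c.1 a.2)
            + ϑ c.2 * (a.1 b.2 - b.1 a.2)) ↔
      ((∀ X Y Z : h, α X Y Z + α Y Z X + α Z X Y = 0) ∧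
       (∀ (X Y : h) (φ : Module.Dual ℝ h),
          ρ X φ Y - ρ Y φ X = -φ ⁅X, Y⁆ - ϑ X * φ Y + ϑ Y * φ X))) := by
  have key : ∀ (φ ψ : Module.Dual ℝ h) (X Y : h),
      B (φ, X) (ψ, Y) = (-(ρ Y φ) + ρ X ψ + α X Y, ⁅X, Y⁆) := by
    intro φ ψ X Y
    have e1 : ((φ, X) : Module.Dual ℝ h × h) = (φ, 0) + (0, X) := by simp
    have e2 : ((ψ, Y) : Module.Dual ℝ h × h) = (ψ, 0) + (0, Y) := by simp
    rw [e1, e2, map_add B, LinearMap.add_apply, map_add, map_add, hB1, hB2, hB3,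
      hBskew (0, X) (ψ, 0), hB2]
    ext <;> simp [add_assoc]
  refine ⟨?_, ?_, ?_⟩
  · rintro ⟨φ, X⟩ ⟨ψ, Y⟩
    rw [key]
    exact hϑclosed X Y
  · intro H
    refine ⟨?_, ?_⟩
    · intro X Y Z
      have := H (0, X) (0, Y) (0, Z)
      simp only [hB3] at this
      have h2 : α Z X Y = - α X Z Y := by rw [hαalt Z X]; rfl
      simp at this
      linarith
    · intro X Y φ
      have := H (φ, 0) (0, X) (0, Y)
      simp only [hB2, hB3] at this
      simp at this
      linarith
  · rintro ⟨H3, H4⟩ ⟨φ, X⟩ ⟨ψ, Y⟩ ⟨χ, Z⟩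
    simp only [key, LinearMap.add_apply, LinearMap.neg_apply]
    have h2 : α Z X Y = - α X Z Y := by rw [hαalt Z X]; rfl
    have a := H3 X Y Z
    have b := H4 Y Z φ
    have c := H4 X Z ψ
    have d := H4 X Y χ
    linarith
end

section
/- Let (g, Ω, ϑ) be an lcs Lie algebra whose center Z(g) is not contained in ker ϑ. Then: (a) the lcs structure is of the first kind; more precisely there is a central U with ϑ(U) = 1, and any such U is an infinitesimal automorphism; (b) for such U, setting η(Y) := -Ω(U, Y) and h := ker ϑ, the functional η restricts to a contact form on h: the skew form (X, Y) ↦ -η([X, Y]) is nondegenerate on h ∩ ker η; (c) g = h ⊕ ℝ·U with U central (so g splits as a Lie algebra direct sum h ⊕ ℝ); and (d) dim Z(g) ≤ 2. -/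
/-- If the center of an lcs Lie algebra `(g, Ω, ϑ)` is not contained
in `ker ϑ`, then the structure is of the first kind via a central `U` with
`ϑ(U) = 1`; for any such `U`, `η = -ι_UΩ` restricts to a contact form on
`h = ker ϑ`, `g = h ⊕ ℝ·U` with `U` central, and `dim Z(g) ≤ 2`. -/
theorem stmt_8
    {g : Type*} [LieRing g] [LieAlgebra ℝ g] [Module.Finite ℝ g]
    (n : ℕ) (hn : 2 ≤ n) (hdim : Module.finrank ℝ g = 2 * n)
    (Ω : g →ₗ[ℝ] g →ₗ[ℝ] ℝ) (ϑ : g →ₗ[ℝ] ℝ)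
    (hΩalt : ∀ X Y : g, Ω X Y = - Ω Y X)
    (hΩnd : ∀ X : g, (∀ Y : g, Ω X Y = 0) → X = 0)
    (hϑ : ϑ ≠ 0)
    (hϑclosed : ∀ X Y : g, ϑ ⁅X, Y⁆ = 0)
    (hlcs : ∀ X Y Z : g,
      -Ω ⁅X, Y⁆ Z + Ω ⁅X, Z⁆ Y - Ω ⁅Y, Z⁆ X
        = ϑ X * Ω Y Z - ϑ Y * Ω X Z + ϑ Z * Ω X Y)
    (hcenter : ∃ Z₀ : g, (∀ Y : g, ⁅Z₀, Y⁆ = 0) ∧ ϑ Z₀ ≠ 0) :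
    (∃ U : g, (∀ Y : g, ⁅U, Y⁆ = 0) ∧ ϑ U = 1) ∧
    (∀ U : g, (∀ Y : g, ⁅U, Y⁆ = 0) → ϑ U = 1 →
      ((∀ Y Z : g, Ω ⁅U, Y⁆ Z + Ω Y ⁅U, Z⁆ = 0) ∧
       (∀ X : g, ϑ X = 0 → -Ω U X = 0 → X ≠ 0 →
          ∃ Y : g, ϑ Y = 0 ∧ -Ω U Y = 0 ∧ -Ω U ⁅X, Y⁆ ≠ 0) ∧
       IsCompl (LinearMap.ker ϑ) (Submodule.span ℝ ({U} : Set g)))) ∧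
    Module.finrank ℝ (LieAlgebra.center ℝ g) ≤ 2 := by
  obtain ⟨Z₀, hZ₀, hZϑ⟩ := hcenter
  have hex : ∃ U : g, (∀ Y : g, ⁅U, Y⁆ = 0) ∧ ϑ U = 1 := by
    refine ⟨(ϑ Z₀)⁻¹ • Z₀, fun Y => ?_, ?_⟩
    · rw [smul_lie, hZ₀, smul_zero]
    · rw [map_smul, smul_eq_mul, inv_mul_cancel₀ hZϑ]
  have hself : ∀ X : g, Ω X X = 0 := fun X => by linarith [hΩalt X X]
  have hinj : Function.Injective Ω := by
    rw [injective_iff_map_eq_zero]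
    intro X hX
    exact hΩnd X (fun Y => by rw [hX]; rfl)
  have hsurj : Function.Surjective Ω :=
    (LinearMap.injective_iff_surjective_of_finrank_eq_finrank
      (Subspace.dual_finrank_eq (K := ℝ) (V := g)).symm).1 hinj
  obtain ⟨V, hV⟩ := hsurj ϑ
  have hVϑ : ϑ V = 0 := by rw [← hV]; exact hself V
  -- the key identity, for a central element with value one under the Lee form
  have key : ∀ U : g, (∀ Y : g, ⁅U, Y⁆ = 0) → ϑ U = 1 → ∀ Y Z : g,
      Ω U ⁅Y, Z⁆ = Ω Y Z - ϑ Y * Ω U Z + ϑ Z * Ω U Y := by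
    intro U hU hU1 Y Z
    have h := hlcs U Y Z
    rw [hU, hU, hU1, map_zero, LinearMap.zero_apply, LinearMap.zero_apply] at h
    linarith [hΩalt U ⁅Y, Z⁆]
  refine ⟨hex, ?_, ?_⟩
  · intro U hU hU1
    have hUV : Ω U V = -1 := by rw [hΩalt, hV, hU1]
    refine ⟨fun Y Z => by simp [hU], ?_, ?_⟩
    · intro X hX hUX hX0
      have hXn : ∃ Y, Ω X Y ≠ 0 := by
        by_contra hc
        push Not at hc
        exact hX0 (hΩnd X hc)
      obtain ⟨Y, hY⟩ := hXn
      have hXU : Ω X U = 0 := by rw [hΩalt]; exact hUX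
      have hXV : Ω X V = 0 := by rw [hΩalt, hV, hX, neg_zero]
      have hY1 : ϑ (Y - ϑ Y • U + Ω U Y • V) = 0 := by simp [hVϑ, hU1]
      have hY2 : Ω U (Y - ϑ Y • U + Ω U Y • V) = 0 := by simp [hself, hUV]
      refine ⟨Y - ϑ Y • U + Ω U Y • V, hY1, by rw [hY2, neg_zero], ?_⟩
      rw [key U hU hU1, hY1, hX, zero_mul, zero_mul]
      simpa [hXU, hXV] using hY
    · rw [isCompl_iff, Submodule.disjoint_def, codisjoint_iff_le_sup]
      constructor
      · intro x hx hxs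
        obtain ⟨a, rfl⟩ := Submodule.mem_span_singleton.1 hxs
        have ha : a = 0 := by simpa [hU1] using hx
        rw [ha, zero_smul]
      · intro x _
        refine Submodule.mem_sup.2 ⟨x - ϑ x • U, by simp [hU1], ϑ x • U,
          Submodule.mem_span_singleton.2 ⟨_, rfl⟩, by simp⟩
  · obtain ⟨U, hU, hU1⟩ := hex
    let f : LieAlgebra.center ℝ g →ₗ[ℝ] ℝ × ℝ :=
      (ϑ.prod (Ω U)).comp (LieAlgebra.center ℝ g).toSubmodule.subtype
    have hf : Function.Injective f := by
      rw [injective_iff_map_eq_zero]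
      rintro ⟨z, hz⟩ h
      have h1 : ϑ z = 0 := congrArg Prod.fst h
      have h2 : Ω U z = 0 := congrArg Prod.snd h
      have hz' : z = 0 := by
        apply hΩnd
        intro Y
        have h3 := key U hU hU1 Y z
        have h4 : ⁅Y, z⁆ = 0 := (LieModule.mem_maxTrivSubmodule ℝ g g z).1 hz Y
        rw [h4, h1, h2, map_zero] at h3
        rw [hΩalt]
        linarith
      exact Subtype.ext hz'
    have := LinearMap.finrank_le_finrank_of_injective hf
    simpa using this
end

section
/- Let (g, Ω, ϑ) be an lcs Lie algebra and let X ∈ g be an infinitesimal automorphism (Ω([X,Y],Z) + Ω(Y,[X,Z]) = 0 for all Y, Z). Then the 1-form ι_XΩ satisfies d(ι_XΩ) - ϑ ∧ ι_XΩ = -ϑ(X)·Ω, explicitly: -Ω(X,[Y,Z]) - ϑ(Y)Ω(X,Z) + ϑ(Z)Ω(X,Y) = -ϑ(X)·Ω(Y,Z) for all Y, Z. In particular, if ϑ(X) = 0 then ι_XΩ is d_ϑ-closed; moreover, if ι_XΩ = c·ϑ for some real number c (i.e. Ω(X,Y) = c·ϑ(Y) for all Y), then X = c·V where V is the characteristic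 vector. -/
/-- For an infinitesimal automorphism `X` of an lcs Lie algebra
`(g, Ω, ϑ)`, the 1-form `ι_XΩ` satisfies `d(ι_XΩ) - ϑ ∧ ι_XΩ = -ϑ(X)·Ω`; in
particular if `ϑ(X) = 0` then `ι_XΩ` is `d_ϑ`-closed, and if `ι_XΩ = c·ϑ` then
`X = c·V` where `V` is the characteristic vector. -/
theorem stmt_9
    {g : Type*} [LieRing g] [LieAlgebra ℝ g] [Module.Finite ℝ g]
    (n : ℕ) (hn : 2 ≤ n) (hdim : Module.finrank ℝ g = 2 * n)
    (Ω : g →ₗ[ℝ] g →ₗ[ℝ] ℝ) (ϑ : g →ₗ[ℝ] ℝ)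
    (hΩalt : ∀ X Y : g, Ω X Y = - Ω Y X)
    (hΩnd : ∀ X : g, (∀ Y : g, Ω X Y = 0) → X = 0)
    (hϑ : ϑ ≠ 0)
    (hϑclosed : ∀ X Y : g, ϑ ⁅X, Y⁆ = 0)
    (hlcs : ∀ X Y Z : g,
      -Ω ⁅X, Y⁆ Z + Ω ⁅X, Z⁆ Y - Ω ⁅Y, Z⁆ X
        = ϑ X * Ω Y Z - ϑ Y * Ω X Z + ϑ Z * Ω X Y)
    (V : g) (hV : ∀ Y : g, Ω V Y = ϑ Y)
    (X : g)
    (haut : ∀ Y Z : g, Ω ⁅X, Y⁆ Z + Ω Y ⁅X, Z⁆ = 0) :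
    (∀ Y Z : g, -Ω X ⁅Y, Z⁆ - ϑ Y * Ω X Z + ϑ Z * Ω X Y = -ϑ X * Ω Y Z) ∧
    (ϑ X = 0 → ∀ Y Z : g, -Ω X ⁅Y, Z⁆ - ϑ Y * Ω X Z + ϑ Z * Ω X Y = 0) ∧
    (∀ c : ℝ, (∀ Y : g, Ω X Y = c * ϑ Y) → X = c • V) := by
  have key : ∀ Y Z : g, -Ω X ⁅Y, Z⁆ - ϑ Y * Ω X Z + ϑ Z * Ω X Y = -ϑ X * Ω Y Z := by
    intro Y Z
    linarith [hlcs X Y Z, haut Y Z, hΩalt ⁅X, Z⁆ Y, hΩalt ⁅Y, Z⁆ X]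
  refine ⟨key, ?_, ?_⟩
  · intro h Y Z
    rw [key, h, neg_zero, zero_mul]
  · intro c hc
    refine sub_eq_zero.mp (hΩnd _ ?_)
    intro Y
    simp [hc, hV]
end

section
/- Let g be a finite-dimensional real reductive Lie algebra (g = [g,g] ⊕ Z(g) as a direct sum of ideals, with the commutator ideal [g,g] semisimple) carrying an lcs structure (Ω, ϑ). Then: (a) dim Z(g) = 1; (b) ker ϑ = [g,g], so ker ϑ is a semisimple Lie algebra; (c) there exists U ∈ Z(g) with ϑ(U) = 1, so the lcs structure is of the first kind and g = (ker ϑ) ⊕ ℝ·U; (d) setting η(Y) := -Ω(U, Y), one has Ω = dη - ϑ∧η (Ω(X,Y) = -η([X,Y]) - ϑ(X)η(Y) + ϑ(Y)η(X) for all X, Y) and η restricts to a contact form on ker ϑ: the skew form (X,Y) ↦ -η([X,Y]) is nondegenerate on ker ϑ ∩ ker η. -/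
/-- A Lie algebra equal to its commutator carrying a nondegenerate exact 2-form is trivial. -/
theorem aux_frobenius {L : Type*} [LieRing L] [LieAlgebra ℝ L] [Module.Finite ℝ L]
    (hperf : ∀ f : L →ₗ[ℝ] ℝ, (∀ X Y : L, f ⁅X, Y⁆ = 0) → f = 0)
    (η : L →ₗ[ℝ] ℝ)
    (hnd : ∀ X : L, (∀ Y : L, η ⁅X, Y⁆ = 0) → X = 0) :
    Module.finrank ℝ L = 0 := by
  let b : L →ₗ[ℝ] Module.Dual ℝ L :=
    (LinearMap.compRight ℝ η).comp (LieAlgebra.ad ℝ L : L →ₗ[ℝ] Module.End ℝ L)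
  have hb : ∀ X Y, b X Y = η ⁅X, Y⁆ := fun X Y => rfl
  have hinj : Function.Injective b := by
    rw [injective_iff_map_eq_zero]
    intro X hX
    apply hnd
    intro Y
    rw [← hb, hX]; rfl
  let e : L ≃ₗ[ℝ] Module.Dual ℝ L :=
    LinearEquiv.ofInjectiveOfFinrankEq b hinj (Subspace.dual_finrank_eq).symm
  have he : ∀ X Y, e X Y = η ⁅X, Y⁆ := fun X Y => rfl
  obtain ⟨T, hT⟩ := e.surjective η
  have hTη : ∀ Y, η ⁅T, Y⁆ = η Y := by
    intro Y
    rw [← he, hT]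
  have htr : LinearMap.trace ℝ L (LieAlgebra.ad ℝ L T) = 0 := by
    have := hperf ((LinearMap.trace ℝ L).comp (LieAlgebra.ad ℝ L : L →ₗ[ℝ] Module.End ℝ L)) (by
      intro X Y
      simp [LieRing.of_associative_ring_bracket, LinearMap.trace_mul_comm ℝ (LieAlgebra.ad ℝ L X)])
    exact LinearMap.congr_fun this T
  have hconj : e.conj (LieAlgebra.ad ℝ L T)
      = Module.Dual.transpose (R := ℝ) (LinearMap.id - LieAlgebra.ad ℝ L T) := by
    apply LinearMap.ext
    intro φ
    obtain ⟨Y, rfl⟩ := e.surjective φ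
    apply LinearMap.ext
    intro Z
    rw [LinearEquiv.conj_apply_apply, LinearEquiv.symm_apply_apply, he]
    change η ⁅⁅T, Y⁆, Z⁆ = e Y (Z - ⁅T, Z⁆)
    rw [he, lie_sub, map_sub, ← hTη ⁅Y, Z⁆, lie_lie, map_sub]
  have h1 := LinearMap.trace_conj' (LieAlgebra.ad ℝ L T) e
  rw [hconj, LinearMap.trace_transpose', map_sub, htr, LinearMap.trace_id] at h1
  have h2 : (Module.finrank ℝ L : ℝ) = 0 := by linarith
  exact_mod_cast h2

/-- A reductive Lie algebra `g` (direct sum of the semisimple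
commutator ideal and the center) with an lcs structure `(Ω, ϑ)` satisfies:
(a) `dim Z(g) = 1`; (b) `ker ϑ = [g,g]`, a semisimple ideal; (c) there is a
central `U` with `ϑ(U) = 1` (so the structure is of the first kind) and
`g = ker ϑ ⊕ ℝ·U`; (d) with `η = -ι_UΩ` one has `Ω = dη - ϑ∧η`, and `η`
restricts to a contact form on `ker ϑ`. -/
theorem stmt_12
    {g : Type*} [LieRing g] [LieAlgebra ℝ g] [Module.Finite ℝ g]
    (n : ℕ) (hn : 2 ≤ n) (hdim : Module.finrank ℝ g = 2 * n)
    (hred : IsCompl ((⁅(⊤ : LieIdeal ℝ g), (⊤ : LieIdeal ℝ g)⁆ : LieIdeal ℝ g) : Submodule ℝ g)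
      ((LieAlgebra.center ℝ g : LieIdeal ℝ g) : Submodule ℝ g))
    (hss : LieAlgebra.IsSemisimple ℝ (⁅(⊤ : LieIdeal ℝ g), (⊤ : LieIdeal ℝ g)⁆ : LieIdeal ℝ g))
    (Ω : g →ₗ[ℝ] g →ₗ[ℝ] ℝ) (ϑ : g →ₗ[ℝ] ℝ)
    (hΩalt : ∀ X Y : g, Ω X Y = - Ω Y X)
    (hΩnd : ∀ X : g, (∀ Y : g, Ω X Y = 0) → X = 0)
    (hϑ : ϑ ≠ 0)
    (hϑclosed : ∀ X Y : g, ϑ ⁅X, Y⁆ = 0)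
    (hlcs : ∀ X Y Z : g,
      -Ω ⁅X, Y⁆ Z + Ω ⁅X, Z⁆ Y - Ω ⁅Y, Z⁆ X
        = ϑ X * Ω Y Z - ϑ Y * Ω X Z + ϑ Z * Ω X Y) :
    Module.finrank ℝ (LieAlgebra.center ℝ g) = 1 ∧
    LinearMap.ker ϑ = ((⁅(⊤ : LieIdeal ℝ g), (⊤ : LieIdeal ℝ g)⁆ : LieIdeal ℝ g) : Submodule ℝ g) ∧
    ∃ U : g, (∀ Y : g, ⁅U, Y⁆ = 0) ∧ ϑ U = 1 ∧
      (∀ Y Z : g, Ω ⁅U, Y⁆ Z + Ω Y ⁅U, Z⁆ = 0) ∧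
      IsCompl (LinearMap.ker ϑ) (Submodule.span ℝ ({U} : Set g)) ∧
      (∀ X Y : g, Ω X Y = -(-Ω U ⁅X, Y⁆) - ϑ X * (-Ω U Y) + ϑ Y * (-Ω U X)) ∧
      (∀ X : g, ϑ X = 0 → -Ω U X = 0 → X ≠ 0 →
        ∃ Y : g, ϑ Y = 0 ∧ -Ω U Y = 0 ∧ -Ω U ⁅X, Y⁆ ≠ 0) := by
  classical
  have hcen : ∀ W : g, W ∈ (LieAlgebra.center ℝ g : LieIdeal ℝ g) → ∀ Y : g, ⁅W, Y⁆ = 0 := by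
    intro W hW Y
    rw [LieModule.mem_maxTrivSubmodule] at hW
    rw [← lie_skew, hW, neg_zero]
  have hϑs : ∀ X : g, X ∈ (⁅(⊤ : LieIdeal ℝ g), (⊤ : LieIdeal ℝ g)⁆ : LieIdeal ℝ g) →
      ϑ X = 0 := by
    intro X hX
    rw [← LieSubmodule.mem_toSubmodule, LieSubmodule.lieIdeal_oper_eq_linear_span'] at hX
    induction hX using Submodule.span_induction with
    | mem x hx => obtain ⟨a, _, b, _, rfl⟩ := hx; exact hϑclosed a b
    | zero => simp
    | add x y _ _ hx hy => simp [hx, hy]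
    | smul a x _ hx => simp [hx]
  have hdec : ∀ X : g, ∃ y z : g,
      y ∈ (⁅(⊤ : LieIdeal ℝ g), (⊤ : LieIdeal ℝ g)⁆ : LieIdeal ℝ g) ∧
      z ∈ (LieAlgebra.center ℝ g : LieIdeal ℝ g) ∧ y + z = X := by
    intro X
    have : X ∈ ((⁅(⊤ : LieIdeal ℝ g), (⊤ : LieIdeal ℝ g)⁆ : LieIdeal ℝ g) : Submodule ℝ g) ⊔
        ((LieAlgebra.center ℝ g : LieIdeal ℝ g) : Submodule ℝ g) := by
      rw [hred.sup_eq_top]; trivial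
    obtain ⟨y, hy, z, hz, h⟩ := Submodule.mem_sup.1 this
    exact ⟨y, z, hy, hz, h⟩
  have hdisj : ∀ X : g, X ∈ (⁅(⊤ : LieIdeal ℝ g), (⊤ : LieIdeal ℝ g)⁆ : LieIdeal ℝ g) →
      X ∈ (LieAlgebra.center ℝ g : LieIdeal ℝ g) → X = 0 := by
    intro X h1 h2
    exact (Submodule.disjoint_def.1 hred.disjoint) X h1 h2
  have hU : ∃ U : g, U ∈ (LieAlgebra.center ℝ g : LieIdeal ℝ g) ∧ ϑ U = 1 := by
    obtain ⟨X, hX⟩ : ∃ X, ϑ X ≠ 0 := by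
      by_contra! h
      exact hϑ (LinearMap.ext h)
    obtain ⟨y, z, hy, hz, rfl⟩ := hdec X
    rw [map_add, hϑs y hy, zero_add] at hX
    exact ⟨(ϑ z)⁻¹ • z, (LieAlgebra.center ℝ g).smul_mem _ hz, by simp [hX]⟩
  obtain ⟨U, hUc, hU1⟩ := hU
  have hU0 := hcen U hUc
  have hself : ∀ X : g, Ω X X = 0 := fun X => by linarith [hΩalt X X]
  have hd : ∀ X Y : g, Ω X Y = Ω U ⁅X, Y⁆ + ϑ X * Ω U Y - ϑ Y * Ω U X := by
    intro X Y
    have h := hlcs U X Y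
    rw [hU0, hU0, hU1, hΩalt ⁅X, Y⁆ U] at h
    simp only [map_zero, LinearMap.zero_apply] at h
    linarith
  have hW0 : ∀ W : g, W ∈ (LieAlgebra.center ℝ g : LieIdeal ℝ g) → ϑ W = 0 → Ω U W = 0 →
      W = 0 := by
    intro W hW h1 h2
    apply hΩnd
    intro Y
    rw [hd, hcen W hW, h1, h2]; simp
  have hWmain : ∀ W : g, W ∈ (LieAlgebra.center ℝ g : LieIdeal ℝ g) → ϑ W = 0 → W = 0 := by
    intro W hW hϑW
    by_contra hne
    have hη : Ω U W ≠ 0 := fun h => hne (hW0 W hW hϑW h)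
    have hs0 := aux_frobenius
      (L := (⁅(⊤ : LieIdeal ℝ g), (⊤ : LieIdeal ℝ g)⁆ : LieIdeal ℝ g)) (by
        intro f hf
        have key : ∀ X : g, ∀ hX : X ∈ Submodule.span ℝ
            {x : g | ∃ a ∈ (⊤ : LieIdeal ℝ g), ∃ b ∈ (⊤ : LieIdeal ℝ g), ⁅a, b⁆ = x},
            ∃ h : X ∈ (⁅(⊤ : LieIdeal ℝ g), (⊤ : LieIdeal ℝ g)⁆ : LieIdeal ℝ g),
              f ⟨X, h⟩ = 0 := by
          intro X hX
          induction hX using Submodule.span_induction with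
          | mem x hx =>
            obtain ⟨a, _, b, _, rfl⟩ := hx
            refine ⟨LieSubmodule.lie_mem_lie trivial trivial, ?_⟩
            obtain ⟨y, z, hy, hz, rfl⟩ := hdec a
            obtain ⟨y', z', hy', hz', rfl⟩ := hdec b
            have e1 : ⁅y + z, y' + z'⁆ = ⁅y, y'⁆ := by
              rw [add_lie, hcen z hz, lie_add, ← lie_skew y z', hcen z' hz']; simp
            rw [← hf ⟨y, hy⟩ ⟨y', hy'⟩]
            congr 1
            exact Subtype.ext e1
          | zero => exact ⟨zero_mem _, map_zero f⟩
          | add x y _ _ hx hy =>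
            obtain ⟨a, ha⟩ := hx
            obtain ⟨b, hb⟩ := hy
            refine ⟨add_mem a b, ?_⟩
            have := map_add f ⟨x, a⟩ ⟨y, b⟩
            rw [ha, hb, add_zero] at this
            exact this
          | smul c x _ hx =>
            obtain ⟨a, ha⟩ := hx
            refine ⟨SMulMemClass.smul_mem c a, ?_⟩
            have := map_smul f c ⟨x, a⟩
            rw [ha, smul_zero] at this
            exact this
        ext ⟨X, hX⟩
        have hX' := hX
        rw [← LieSubmodule.mem_toSubmodule, LieSubmodule.lieIdeal_oper_eq_linear_span'] at hX'
        obtain ⟨_, h⟩ := key X hX'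
        exact h)
      ((Ω U).comp (Submodule.subtype _))
      (by
        rintro ⟨X, hX⟩ h
        have hXz : X + (-(Ω U X) / Ω U W) • W = 0 := by
          apply hΩnd
          intro Y
          obtain ⟨y, z, hy, hz, rfl⟩ := hdec Y
          have h1 : Ω U ⁅X, y⁆ = 0 := h ⟨y, hy⟩
          have e1 : ⁅X + (-(Ω U X) / Ω U W) • W, y + z⁆ = ⁅X, y⁆ := by
            rw [add_lie, smul_lie, hcen W hW, lie_add, ← lie_skew X z, hcen z hz]; simp
          rw [hd, e1, h1]
          simp only [map_add, map_smul, hϑW, hϑs X hX, smul_eq_mul]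
          field_simp
          ring
        have hXc : X ∈ (LieAlgebra.center ℝ g : LieIdeal ℝ g) := by
          rw [eq_neg_of_add_eq_zero_left hXz]
          exact neg_mem ((LieAlgebra.center ℝ g).smul_mem _ hW)
        exact Subtype.ext (hdisj X hX hXc))
    have hsub : ∀ y : g, y ∈ (⁅(⊤ : LieIdeal ℝ g), (⊤ : LieIdeal ℝ g)⁆ : LieIdeal ℝ g) →
        y = 0 := by
      intro y hy
      have := Module.finrank_zero_iff.1 hs0
      exact congrArg Subtype.val (Subsingleton.elim
        (⟨y, hy⟩ : (⁅(⊤ : LieIdeal ℝ g), (⊤ : LieIdeal ℝ g)⁆ : LieIdeal ℝ g)) 0)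
    have hinj : Function.Injective (ϑ.prod (Ω U)) := by
      rw [injective_iff_map_eq_zero]
      intro X hX
      obtain ⟨y, z, hy, hz, rfl⟩ := hdec X
      rw [hsub y hy, zero_add] at hX ⊢
      exact hW0 z hz (congrArg Prod.fst hX) (congrArg Prod.snd hX)
    have hle := LinearMap.finrank_le_finrank_of_injective hinj
    rw [hdim, Module.finrank_prod, Module.finrank_self] at hle
    omega
  have hker : LinearMap.ker ϑ =
      ((⁅(⊤ : LieIdeal ℝ g), (⊤ : LieIdeal ℝ g)⁆ : LieIdeal ℝ g) : Submodule ℝ g) := by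
    apply le_antisymm
    · intro X hX
      obtain ⟨y, z, hy, hz, rfl⟩ := hdec X
      rw [LinearMap.mem_ker, map_add, hϑs y hy, zero_add] at hX
      rw [hWmain z hz hX, add_zero]
      exact hy
    · intro X hX
      exact hϑs X hX
  have hUne : U ≠ 0 := by
    rintro rfl
    simp at hU1
  refine ⟨?_, hker, U, hU0, hU1, ?_, ?_, ?_, ?_⟩
  · refine finrank_eq_one (⟨U, hUc⟩ : LieAlgebra.center ℝ g) ?_ ?_
    · intro h
      exact hUne (congrArg Subtype.val h)
    · rintro ⟨W, hW⟩
      refine ⟨ϑ W, ?_⟩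
      apply Subtype.ext
      change ϑ W • U = W
      have := hWmain (W - ϑ W • U) (sub_mem hW ((LieAlgebra.center ℝ g).smul_mem _ hUc))
        (by simp [hU1])
      exact (sub_eq_zero.1 this).symm
  · intro Y Z
    simp [hU0]
  · constructor
    · rw [Submodule.disjoint_def]
      intro X hX hX'
      obtain ⟨c, rfl⟩ := Submodule.mem_span_singleton.1 hX'
      have : c = 0 := by simpa [hU1] using hX
      simp [this]
    · rw [codisjoint_iff, eq_top_iff]
      intro X _
      refine Submodule.mem_sup.2 ⟨X - ϑ X • U, by simp [hU1], ϑ X • U,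
        Submodule.mem_span_singleton.2 ⟨_, rfl⟩, by simp⟩
  · intro X Y
    rw [hd X Y]
    ring
  · intro X hX hηX hXne
    have hηX' : Ω U X = 0 := by linarith
    have hinj : Function.Injective Ω := by
      rw [injective_iff_map_eq_zero]
      intro A hA
      exact hΩnd A (fun Y => by rw [hA]; rfl)
    obtain ⟨R, hR⟩ : ∃ R, Ω R = ϑ :=
      (LinearMap.injective_iff_surjective_of_finrank_eq_finrank
        (Subspace.dual_finrank_eq (K := ℝ) (V := g)).symm).1 hinj ϑ
    have hϑR : ϑ R = 0 := by rw [← hR]; exact hself R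
    have hUR : Ω U R = -1 := by rw [hΩalt, hR, hU1]
    have hXR : Ω U ⁅X, R⁆ = 0 := by
      have h1 := hd X R
      rw [hΩalt X R, hR, hX, hϑR] at h1
      linarith
    obtain ⟨Y, hY⟩ : ∃ Y, Ω X Y ≠ 0 := by
      by_contra! h
      exact hXne (hΩnd X h)
    have hXY := hd X Y
    rw [hX, hηX'] at hXY
    have hXU : ⁅X, U⁆ = 0 := by rw [← lie_skew, hU0, neg_zero]
    refine ⟨Y - ϑ Y • U + Ω U Y • R, ?_, ?_, ?_⟩
    · simp [hU1, hϑR]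
    · simp [hself, hUR]
    · simp only [lie_add, lie_sub, lie_smul, hXU, map_add, map_sub, map_smul, hXR, smul_zero,
        sub_zero, add_zero, map_zero]
      intro h
      apply hY
      linarith
end

section
/- Let g be a finite-dimensional real Lie algebra, ϑ : g → ℝ a closed linear functional (ϑ([X,Y]) = 0 for all X, Y), α ≠ 0 a real number, and U ∈ g with ϑ(U) = -α; set h := ker ϑ. Let η : g → ℝ be linear with η(U) = 0, and let ω be an alternating bilinear form on g with ω(U, Y) = 0 for all Y. Assume: (i) η([X,Y]) = 0 for all X, Y ∈ h (d^h η = 0); (ii) -ω([X,Y],Z) + ω([X,Z],Y) - ω([Y,Z],X) = 0 for all X, Y, Z ∈ h (d^h ω = 0); (iii) there is R ∈ h with η(R) = 1 and ω(R, Y) = 0 for all Y ∈ h; (iv) for every nonzero X ∈ h with η(X) = 0 there is Y ∈ h with η(Y) = 0 and ω(X, Y) ≠ 0 (so (η, ω) is a cosymplectic structure on h with Reeb vector R); (v) ω([U,X], Y) + ω(X, [U,Y]) = α·ω(X, Y) for all X, Y ∈ h (the derivation D = ad U of h satisfies D*ω = α·ω). Then the alternating form Ω(X, Y) := ω(X,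 Y) + η(X)ϑ(Y) - ϑ(X)η(Y) (that is, Ω = ω + η∧ϑ) is nondegenerate and (Ω, ϑ) is an lcs structure on g. -/
/-- Given a cosymplectic Lie algebra `(h = ker ϑ, η, ω)` with Reeb
vector `R` inside `g`, and `U` with `ϑ(U) = -α ≠ 0`, `η(U) = 0`, `ι_Uω = 0`,
such that the derivation `D = ad U` of `h` satisfies `D*ω = α·ω`, the form
`Ω = ω + η∧ϑ` is nondegenerate and `(Ω, ϑ)` is an lcs structure on `g`. -/
theorem stmt_16
    {g : Type*} [LieRing g] [LieAlgebra ℝ g] [Module.Finite ℝ g]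
    (ϑ η : g →ₗ[ℝ] ℝ)
    (hϑclosed : ∀ X Y : g, ϑ ⁅X, Y⁆ = 0)
    (α : ℝ) (hα : α ≠ 0)
    (U : g) (hUϑ : ϑ U = -α)
    (ω : g →ₗ[ℝ] g →ₗ[ℝ] ℝ)
    (hωalt : ∀ X Y : g, ω X Y = - ω Y X)
    (hηU : η U = 0) (hωU : ∀ Y : g, ω U Y = 0)
    (hηclosed : ∀ X Y : g, ϑ X = 0 → ϑ Y = 0 → η ⁅X, Y⁆ = 0)
    (hωclosed : ∀ X Y Z : g, ϑ X = 0 → ϑ Y = 0 → ϑ Z = 0 →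
      -ω ⁅X, Y⁆ Z + ω ⁅X, Z⁆ Y - ω ⁅Y, Z⁆ X = 0)
    (R : g) (hRϑ : ϑ R = 0) (hRη : η R = 1)
    (hRω : ∀ Y : g, ϑ Y = 0 → ω R Y = 0)
    (hωnd : ∀ X : g, ϑ X = 0 → η X = 0 → X ≠ 0 →
      ∃ Y : g, ϑ Y = 0 ∧ η Y = 0 ∧ ω X Y ≠ 0)
    (hD : ∀ X Y : g, ϑ X = 0 → ϑ Y = 0 →
      ω ⁅U, X⁆ Y + ω X ⁅U, Y⁆ = α * ω X Y)
    (Ω : g →ₗ[ℝ] g →ₗ[ℝ] ℝ)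
    (hΩ : ∀ X Y : g, Ω X Y = ω X Y + η X * ϑ Y - ϑ X * η Y) :
    ϑ ≠ 0 ∧
    (∀ X : g, (∀ Y : g, Ω X Y = 0) → X = 0) ∧
    (∀ X Y Z : g,
      -Ω ⁅X, Y⁆ Z + Ω ⁅X, Z⁆ Y - Ω ⁅Y, Z⁆ X
        = ϑ X * Ω Y Z - ϑ Y * Ω X Z + ϑ Z * Ω X Y) := by
  have hωU' : ∀ Y : g, ω Y U = 0 := fun Y => by rw [hωalt, hωU, neg_zero]
  have dec : ∀ X : g, ∃ (x : g) (a : ℝ), ϑ x = 0 ∧ X = x + a • U := fun X =>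
    ⟨X + (ϑ X / α) • U, -(ϑ X / α), by
      simp only [map_add, map_smul, smul_eq_mul, hUϑ]
      field_simp
      ring, by module⟩
  refine ⟨?_, ?_, ?_⟩
  · intro h
    apply hα
    rw [h] at hUϑ
    simpa using hUϑ.symm
  · intro X hX
    have h1 : η X = 0 := by
      have h := hX U
      rw [hΩ, hωU', hηU, hUϑ] at h
      have h' : η X * α = 0 := by linear_combination -h
      exact (mul_eq_zero.mp h').resolve_right hα
    have h2 : ϑ X = 0 := by
      have h := hX R
      have hR : ω R X = 0 := by
        obtain ⟨x, a, hx, rfl⟩ := dec X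
        simp [hRω x hx, hωU']
      rw [hΩ, hωalt, hR, hRϑ, hRη] at h
      linear_combination -h
    by_contra hne
    obtain ⟨Y, hY1, hY2, hY3⟩ := hωnd X h2 h1 hne
    apply hY3
    have h := hX Y
    rw [hΩ, hY1, hY2] at h
    linear_combination h
  · intro X Y Z
    obtain ⟨x, a, hx, rfl⟩ := dec X
    obtain ⟨y, b, hy, rfl⟩ := dec Y
    obtain ⟨z, c, hz, rfl⟩ := dec Z
    have br : ∀ (x y : g) (a b : ℝ),
        ⁅x + a • U, y + b • U⁆ = ⁅x, y⁆ - b • ⁅U, x⁆ + a • ⁅U, y⁆ := by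
      intro x y a b
      simp only [add_lie, lie_add, smul_lie, lie_smul, lie_self, smul_zero, add_zero]
      rw [← lie_skew U x]
      module
    simp only [hΩ, hϑclosed, br]
    simp only [map_add, map_sub, map_smul, LinearMap.add_apply, LinearMap.sub_apply,
      LinearMap.smul_apply, smul_eq_mul, hωU, hωU', hϑclosed, hx, hy, hz, hUϑ, hηU,
      hηclosed x y hx hy, hηclosed x z hx hz, hηclosed y z hy hz]
    linear_combination hωclosed x y z hx hy hz - a * hD y z hy hz + b * hD x z hx hz
      - c * hD x y hx hy + a * hωalt ⁅U, z⁆ y - b * hωalt ⁅U, z⁆ x + c * hωalt ⁅U, y⁆ x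
end

section
/- In the setting of the cosymplectic construction — g a real Lie algebra of dimension 2n (n ≥ 2), ϑ closed with ϑ(U) = -α, α ≠ 0, h = ker ϑ of dimension 2n-1, (η, ω) a cosymplectic structure on h with Reeb vector R (η(R) = 1, ω(R, ·) = 0 on h, η and ω closed on h, ω nondegenerate on h ∩ ker η), η(U) = 0, ω(U, ·) = 0, and ω([U,X],Y) + ω(X,[U,Y]) = α·ω(X,Y) for X, Y ∈ h — the Lie algebra g is unimodular if and only if h is unimodular and η([U, R]) = -α(n-1) (equivalently, the derivation D = ad U satisfies D*η = -α(n-1)·η + ζ for some functional ζ on h vanishing on R). -/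
theorem trace_skew_zero {V : Type*} [AddCommGroup V] [Module ℝ V] [Module.Finite ℝ V]
    (B : V →ₗ[ℝ] V →ₗ[ℝ] ℝ) (hB : Function.Injective B) (S : V →ₗ[ℝ] V)
    (hS : ∀ X Y, B (S X) Y = - B X (S Y)) : LinearMap.trace ℝ V S = 0 := by
  have e0 : Module.finrank ℝ V = Module.finrank ℝ (Module.Dual ℝ V) :=
    (Subspace.dual_finrank_eq).symm
  let e : V ≃ₗ[ℝ] Module.Dual ℝ V := LinearMap.linearEquivOfInjective B hB e0
  have he : ∀ x, e x = B x := fun x => rfl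
  have h1 : e.conj (-S) = Module.Dual.transpose (R := ℝ) S := by
    refine LinearMap.ext fun f => ?_
    obtain ⟨X, rfl⟩ := e.surjective f
    refine LinearMap.ext fun Y => ?_
    rw [LinearEquiv.conj_apply_apply, e.symm_apply_apply, Module.Dual.transpose_apply,
      LinearMap.comp_apply, he, he, LinearMap.neg_apply, map_neg, LinearMap.neg_apply, hS, neg_neg]
  have h2 := LinearMap.trace_conj' (-S) e
  rw [h1, LinearMap.trace_transpose', map_neg] at h2
  linarith

/-- In the cosymplectic construction (`g` of dimension `2n`,
`h = ker ϑ` of dimension `2n-1` with cosymplectic structure `(η, ω)` and Reeb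
vector `R`, `ϑ(U) = -α ≠ 0`, `η(U) = 0`, `ι_Uω = 0`, `D*ω = α·ω` for
`D = ad U`), the Lie algebra `g` is unimodular if and only if `h` is unimodular
and `η([U,R]) = -α(n-1)`. -/
theorem stmt_17
    {g : Type*} [LieRing g] [LieAlgebra ℝ g] [Module.Finite ℝ g]
    (n : ℕ) (hn : 2 ≤ n) (hdim : Module.finrank ℝ g = 2 * n)
    (ϑ η : g →ₗ[ℝ] ℝ)
    (hϑclosed : ∀ X Y : g, ϑ ⁅X, Y⁆ = 0)
    (h : LieSubalgebra ℝ g) (hh : h.toSubmodule = LinearMap.ker ϑ)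
    (hhdim : Module.finrank ℝ h = 2 * n - 1)
    (α : ℝ) (hα : α ≠ 0)
    (U : g) (hUϑ : ϑ U = -α)
    (ω : g →ₗ[ℝ] g →ₗ[ℝ] ℝ)
    (hωalt : ∀ X Y : g, ω X Y = - ω Y X)
    (hηU : η U = 0) (hωU : ∀ Y : g, ω U Y = 0)
    (hηclosed : ∀ X Y : g, ϑ X = 0 → ϑ Y = 0 → η ⁅X, Y⁆ = 0)
    (hωclosed : ∀ X Y Z : g, ϑ X = 0 → ϑ Y = 0 → ϑ Z = 0 →
      -ω ⁅X, Y⁆ Z + ω ⁅X, Z⁆ Y - ω ⁅Y, Z⁆ X = 0)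
    (R : g) (hRϑ : ϑ R = 0) (hRη : η R = 1)
    (hRω : ∀ Y : g, ϑ Y = 0 → ω R Y = 0)
    (hωnd : ∀ X : g, ϑ X = 0 → η X = 0 → X ≠ 0 →
      ∃ Y : g, ϑ Y = 0 ∧ η Y = 0 ∧ ω X Y ≠ 0)
    (hD : ∀ X Y : g, ϑ X = 0 → ϑ Y = 0 →
      ω ⁅U, X⁆ Y + ω X ⁅U, Y⁆ = α * ω X Y) :
    (∀ X : g, LinearMap.trace ℝ g (LieAlgebra.ad ℝ g X) = 0) ↔
      ((∀ X : h, LinearMap.trace ℝ h (LieAlgebra.ad ℝ h X) = 0) ∧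
        η ⁅U, R⁆ = -α * ((n : ℝ) - 1)) := by
  have hadh : ∀ X : h, LinearMap.trace ℝ h (LieAlgebra.ad ℝ h X)
      = LinearMap.trace ℝ g (LieAlgebra.ad ℝ g (X : g)) := by
    intro X
    have hm : ∀ Y : g, LieAlgebra.ad ℝ g (X : g) Y ∈ h.toSubmodule := by
      intro Y
      rw [hh]
      simp [hϑclosed]
    rw [← LinearMap.trace_restrict_eq_of_forall_mem h.toSubmodule _ hm]
    rfl
  have hmem : ∀ X : g, X ∈ h ↔ ϑ X = 0 := by
    intro X
    rw [← LieSubalgebra.mem_toSubmodule, hh, LinearMap.mem_ker]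
  have hωU' : ∀ Y : g, ω Y U = 0 := fun Y => by rw [hωalt, hωU, neg_zero]
  have hωR : ∀ Y : g, ω R Y = 0 := by
    intro Y
    have h1 := hRω (Y + (ϑ Y / α) • U) (by simp [hUϑ]; field_simp; ring)
    simpa [hωU'] using h1
  have hωR' : ∀ Y : g, ω Y R = 0 := fun Y => by rw [hωalt, hωR, neg_zero]
  let T : g →ₗ[ℝ] g := LieAlgebra.ad ℝ g U
  have hT : ∀ X, T X = ⁅U, X⁆ := fun X => rfl
  let P : g →ₗ[ℝ] g := LinearMap.id - η.smulRight R + α⁻¹ • ϑ.smulRight U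
  have hP : ∀ X, P X = X - η X • R + α⁻¹ • ϑ X • U := fun X => rfl
  have hPϑ : ∀ X, ϑ (P X) = 0 := by
    intro X
    simp [hP, hRϑ, hUϑ]; field_simp; ring
  have hPη : ∀ X, η (P X) = 0 := by
    intro X
    simp [hP, hRη, hηU]
  have hPω : ∀ X Y, ω (P X) Y = ω X Y := by
    intro X Y
    simp [hP, hωR, hωU]
  have hPω' : ∀ X Y, ω X (P Y) = ω X Y := by
    intro X Y
    simp [hP, hωR', hωU']
  have hPP : P ∘ₗ P = P := by
    ext X
    rw [LinearMap.comp_apply, hP (P X), hPϑ, hPη]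
    simp
  let B : g →ₗ[ℝ] g →ₗ[ℝ] ℝ := ω + η.smulRight η + ϑ.smulRight ϑ
  have hB : ∀ X Y, B X Y = ω X Y + η X * η Y + ϑ X * ϑ Y := fun X Y => rfl
  have hBinj : Function.Injective B := by
    rw [injective_iff_map_eq_zero]
    intro X hX
    have hX' : ∀ Y, ω X Y + η X * η Y + ϑ X * ϑ Y = 0 := by
      intro Y
      rw [← hB, hX]; rfl
    have h1 : ϑ X = 0 := by
      have := hX' U
      rw [hωU', hηU, hUϑ] at this
      simpa [hα] using this
    have h2 : η X = 0 := by
      have := hX' R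
      rw [hωR', hRη, hRϑ] at this
      simpa using this
    by_contra hne
    obtain ⟨Y, -, -, hY⟩ := hωnd X h1 h2 hne
    have := hX' Y
    rw [h1, h2] at this
    exact hY (by simpa using this)
  have hskew := trace_skew_zero B hBinj (P ∘ₗ T ∘ₗ P - (α / 2) • P) (by
    intro X Y
    have h1 := hD (P X) (P Y) (hPϑ X) (hPϑ Y)
    simp only [hPω, hPω'] at h1
    simp only [hB, LinearMap.sub_apply, LinearMap.smul_apply, LinearMap.comp_apply, map_sub,
      map_smul, hPϑ, hPη, hPω, hPω', hT, smul_eq_mul]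
    have h2 : ω ⁅U, P X⁆ (P Y) = ω ⁅U, P X⁆ Y := hPω' _ _
    linarith)
  have htP : LinearMap.trace ℝ g P = 2 * n - 2 := by
    simp only [P, map_add, map_sub, map_smul, LinearMap.trace_id, LinearMap.trace_smulRight, hdim,
      hRη, hUϑ, smul_eq_mul]
    push_cast
    field_simp
    ring
  have htTP : LinearMap.trace ℝ g (P ∘ₗ T ∘ₗ P) = LinearMap.trace ℝ g T - η ⁅U, R⁆ := by
    rw [LinearMap.trace_comp_comm', LinearMap.comp_assoc, hPP, LinearMap.trace_comp_comm']
    have : P ∘ₗ T = T - (η ∘ₗ T).smulRight R := by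
      ext X
      simp [hP, hT, hϑclosed]
    rw [this, map_sub, LinearMap.trace_smulRight]
    rfl
  have key : LinearMap.trace ℝ g T = η ⁅U, R⁆ + α * (n - 1) := by
    rw [map_sub, map_smul, htTP, htP, smul_eq_mul] at hskew
    linarith
  constructor
  · intro H
    refine ⟨fun X => by rw [hadh, H], ?_⟩
    have := H U
    change LinearMap.trace ℝ g T = 0 at this
    linarith
  · rintro ⟨H1, H2⟩ X
    have hU0 : LinearMap.trace ℝ g (LieAlgebra.ad ℝ g U) = 0 := by
      change LinearMap.trace ℝ g T = 0
      linarith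
    have hZ : ϑ (X + (ϑ X / α) • U) = 0 := by
      simp [hUϑ]; field_simp; ring
    have h1 := H1 ⟨X + (ϑ X / α) • U, (hmem _).2 hZ⟩
    rw [hadh] at h1
    simpa [hU0] using h1
end

section
/- In the setting of the cosymplectic construction — g a real Lie algebra of dimension 2n (n ≥ 2), ϑ closed with ϑ(U) = -α, α ≠ 0, h = ker ϑ, (η, ω) a cosymplectic structure on h with Reeb vector R, η(U) = 0, ω(U, ·) = 0, and ω([U,X],Y) + ω(X,[U,Y]) = α·ω(X,Y) for X, Y ∈ h, with Ω := ω + η∧ϑ the resulting lcs form — if h is unimodular, then the lcs structure (Ω, ϑ) is not exact: there is no linear functional υ : g → ℝ such that Ω(X, Y) = -υ([X,Y]) - ϑ(X)υ(Y) + ϑ(Y)υ(X) for all X, Y. -/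
theorem aux_not_unimodular {L : Type*} [LieRing L] [LieAlgebra ℝ L] [Module.Finite ℝ L]
    (hd : Module.finrank ℝ L ≠ 1) (η υ : L →ₗ[ℝ] ℝ) (R : L) (hRη : η R = 1)
    (hη : ∀ X Y : L, η ⁅X, Y⁆ = 0) (hR : ∀ Y : L, υ ⁅R, Y⁆ = 0)
    (hnd : ∀ X : L, η X = 0 → X ≠ 0 → ∃ Y : L, υ ⁅X, Y⁆ ≠ 0)
    (hu : ∀ X : L, LinearMap.trace ℝ L (LieAlgebra.ad ℝ L X) = 0) : False := by
  -- b Y = (X ↦ -υ [X,Y] + η X η Y)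
  let b : L →ₗ[ℝ] Module.Dual ℝ L :=
    LinearMap.mk₂ ℝ (fun Y X => -υ ⁅X, Y⁆ + η X * η Y)
      (by intros; simp; ring) (by intros; simp; ring)
      (by intros; simp; ring) (by intros; simp; ring)
  have hb : ∀ Y X, b Y X = -υ ⁅X, Y⁆ + η X * η Y := fun _ _ => rfl
  have hinj : Function.Injective b := by
    rw [injective_iff_map_eq_zero]
    intro Y hY
    have h1 : ∀ X, -υ ⁅X, Y⁆ + η X * η Y = 0 := fun X => by rw [← hb, hY]; rfl
    have h2 : η Y = 0 := by simpa [hR, hRη] using h1 R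
    by_contra hne
    obtain ⟨X, hX⟩ := hnd Y h2 hne
    apply hX
    have := h1 X
    rw [← lie_skew, map_neg, h2] at this
    linarith
  let e : L ≃ₗ[ℝ] Module.Dual ℝ L :=
    LinearEquiv.ofInjectiveOfFinrankEq b hinj (Subspace.dual_finrank_eq).symm
  have he : ∀ Y X, e Y X = -υ ⁅X, Y⁆ + η X * η Y := fun _ _ => rfl
  obtain ⟨Z, hZ⟩ := e.surjective (υ - υ R • η)
  have hZ' : ∀ X, -υ ⁅X, Z⁆ + η X * η Z = υ X - υ R * η X := fun X => by
    rw [← he, hZ]; rfl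
  have hηZ : η Z = 0 := by simpa [hR, hRη] using hZ' R
  have hZ2 : ∀ X Y : L, υ ⁅Z, ⁅X, Y⁆⁆ = υ ⁅X, Y⁆ := fun X Y => by
    have := hZ' ⁅X, Y⁆
    rw [hη, ← lie_skew ⁅X, Y⁆ Z, map_neg] at this
    linarith
  set A : L →ₗ[ℝ] L := LieAlgebra.ad ℝ L Z with hA
  let C : L →ₗ[ℝ] L := LinearMap.id - η.smulRight R - A
  have hC : A.dualMap = e.conj C := by
    ext f X
    obtain ⟨Y, rfl⟩ := e.surjective f
    have h3 := hZ2 X Y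
    rw [leibniz_lie, map_add] at h3
    have h4 := hR X
    rw [← lie_skew, map_neg] at h4
    simp [LinearEquiv.conj_apply, he, C, A, hη, hRη]
    rw [h4, hZ2 X Y]
    ring
  have ht : LinearMap.trace ℝ L A = LinearMap.trace ℝ L C := by
    rw [← LinearMap.trace_conj' C e, ← hC]
    exact (LinearMap.trace_transpose' A).symm
  have hs : LinearMap.trace ℝ L (η.smulRight R) = 1 := by
    rw [LinearMap.trace_smulRight, hRη]
  simp only [C, map_sub, hs, LinearMap.trace_id, hA, hu] at ht
  apply hd
  have : (Module.finrank ℝ L : ℝ) = 1 := by linarith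
  exact_mod_cast this

/-- In the cosymplectic construction (`h = ker ϑ` with
cosymplectic structure `(η, ω)` and Reeb vector `R`, `ϑ(U) = -α ≠ 0`,
`η(U) = 0`, `ι_Uω = 0`, `D*ω = α·ω` for `D = ad U`), if `h` is unimodular then
the lcs structure `(Ω = ω + η∧ϑ, ϑ)` is not exact: no linear functional `υ`
satisfies `Ω = dυ - ϑ∧υ`. -/
theorem stmt_18
    {g : Type*} [LieRing g] [LieAlgebra ℝ g] [Module.Finite ℝ g]
    (n : ℕ) (hn : 2 ≤ n) (hdim : Module.finrank ℝ g = 2 * n)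
    (ϑ η : g →ₗ[ℝ] ℝ)
    (hϑclosed : ∀ X Y : g, ϑ ⁅X, Y⁆ = 0)
    (h : LieSubalgebra ℝ g) (hh : h.toSubmodule = LinearMap.ker ϑ)
    (α : ℝ) (hα : α ≠ 0)
    (U : g) (hUϑ : ϑ U = -α)
    (ω : g →ₗ[ℝ] g →ₗ[ℝ] ℝ)
    (hωalt : ∀ X Y : g, ω X Y = - ω Y X)
    (hηU : η U = 0) (hωU : ∀ Y : g, ω U Y = 0)
    (hηclosed : ∀ X Y : g, ϑ X = 0 → ϑ Y = 0 → η ⁅X, Y⁆ = 0)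
    (hωclosed : ∀ X Y Z : g, ϑ X = 0 → ϑ Y = 0 → ϑ Z = 0 →
      -ω ⁅X, Y⁆ Z + ω ⁅X, Z⁆ Y - ω ⁅Y, Z⁆ X = 0)
    (R : g) (hRϑ : ϑ R = 0) (hRη : η R = 1)
    (hRω : ∀ Y : g, ϑ Y = 0 → ω R Y = 0)
    (hωnd : ∀ X : g, ϑ X = 0 → η X = 0 → X ≠ 0 →
      ∃ Y : g, ϑ Y = 0 ∧ η Y = 0 ∧ ω X Y ≠ 0)
    (hD : ∀ X Y : g, ϑ X = 0 → ϑ Y = 0 →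
      ω ⁅U, X⁆ Y + ω X ⁅U, Y⁆ = α * ω X Y)
    (Ω : g →ₗ[ℝ] g →ₗ[ℝ] ℝ)
    (hΩ : ∀ X Y : g, Ω X Y = ω X Y + η X * ϑ Y - ϑ X * η Y)
    (hhuni : ∀ X : h, LinearMap.trace ℝ h (LieAlgebra.ad ℝ h X) = 0) :
    ¬ ∃ υ : g →ₗ[ℝ] ℝ, ∀ X Y : g,
        Ω X Y = -υ ⁅X, Y⁆ - ϑ X * υ Y + ϑ Y * υ X := by
  rintro ⟨υ, hυ⟩
  have hmem : ∀ X : h, ϑ X = 0 := fun X => by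
    have : (X : g) ∈ h.toSubmodule := X.2
    rw [hh] at this
    exact this
  have hmem' : ∀ X : g, ϑ X = 0 → X ∈ h := fun X hX => by
    have : X ∈ h.toSubmodule := by rw [hh]; exact hX
    exact this
  have hω : ∀ X Y : g, ϑ X = 0 → ϑ Y = 0 → ω X Y = -υ ⁅X, Y⁆ := fun X Y hX hY => by
    have := hυ X Y
    rw [hΩ, hX, hY] at this
    linarith
  have hfin : Module.finrank ℝ h ≠ 1 := by
    have h1 := LinearMap.finrank_range_add_finrank_ker ϑ
    have h2 : Module.finrank ℝ (LinearMap.range ϑ) ≤ 1 := by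
      simpa using Submodule.finrank_le (LinearMap.range ϑ)
    have h3 : Module.finrank ℝ h = Module.finrank ℝ (LinearMap.ker ϑ) := by
      rw [← hh]; rfl
    omega
  refine aux_not_unimodular (L := h) hfin (η.comp h.toSubmodule.subtype)
    (υ.comp h.toSubmodule.subtype) ⟨R, hmem' R hRϑ⟩ hRη
    (fun X Y => hηclosed X Y (hmem X) (hmem Y)) (fun Y => ?_) (fun X hX hne => ?_) hhuni
  · have := hω R Y hRϑ (hmem Y)
    rw [hRω Y (hmem Y)] at this
    change υ ⁅R, (Y : g)⁆ = 0
    linarith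
  · obtain ⟨Y, hY, -, hXY⟩ := hωnd X (hmem X) hX (fun h0 => hne (Subtype.ext h0))
    refine ⟨⟨Y, hmem' Y hY⟩, ?_⟩
    change υ ⁅(X : g), Y⁆ ≠ 0
    intro h0
    rw [hω X Y (hmem X) hY, h0, neg_zero] at hXY
    exact hXY rfl
end
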